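/- arXiv:2103.00048 — 2 statements merged into one kernel-verified Lean document; each statement's English description precedes it below -/
import Mathlib

section
/- The operators d, h, z on R_n = ℤ[x_1,…,x_n] satisfy the sl₂ relations as ℤ-linear endomorphisms of R_n: [h, d] = 2d, [h, z] = −2z, and [z, d] = h, where [a,b] = a∘b − b∘a. Equivalently, setting e = d and f = −z, the triple (e, h, f) satisfies [h,e] = 2e, [h,f] = −2f, [e,f] = h, so (d, h, −z) is an sl₂-triple acting on the polynomial ring R_n. -/
open MvPolynomial

/-- The raising operator `d` on `R_n = ℤ[x_1,…,x_n]`: `d(p) = Σ_i x_i² · ∂p/∂x_i`. -/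
noncomputable def dOp (n : ℕ) :
    MvPolynomial (Fin n) ℤ →ₗ[ℤ] MvPolynomial (Fin n) ℤ :=
  ∑ i : Fin n, (LinearMap.mulLeft ℤ (X i ^ 2)).comp (pderiv i).toLinearMap

/-- The lowering operator `z` on `R_n = ℤ[x_1,…,x_n]`: `z(p) = Σ_i ∂p/∂x_i`. -/
noncomputable def zOp (n : ℕ) :
    MvPolynomial (Fin n) ℤ →ₗ[ℤ] MvPolynomial (Fin n) ℤ :=
  ∑ i : Fin n, (pderiv i).toLinearMap

/-- The grading operator `h` on `R_n = ℤ[x_1,…,x_n]`: `h(p) = 2·Σ_i x_i · ∂p/∂x_i`. -/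
noncomputable def hOp (n : ℕ) :
    MvPolynomial (Fin n) ℤ →ₗ[ℤ] MvPolynomial (Fin n) ℤ :=
  2 • ∑ i : Fin n, (LinearMap.mulLeft ℤ (X i)).comp (pderiv i).toLinearMap

/-- The derivation `Σ_i f_i · ∂/∂x_i` is the one sending each `x_i` to `f_i`. -/
theorem mkDerivation_apply_eq_sum_pderiv {R σ : Type*} [CommSemiring R] [Fintype σ]
    (f : σ → MvPolynomial σ R) (p : MvPolynomial σ R) :
    mkDerivation R f p = ∑ i, f i * pderiv i p := by
  classical
  have sum_apply (q : MvPolynomial σ R) :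
      (∑ i, f i • pderiv i : Derivation R (MvPolynomial σ R) (MvPolynomial σ R)) q =
        ∑ i, f i * pderiv i q := by
    simpa only [Finset.sum_apply, Derivation.coeFnAddMonoidHom_apply, Derivation.smul_apply,
      smul_eq_mul] using
      congrFun (map_sum Derivation.coeFnAddMonoidHom (fun i => f i • pderiv i) Finset.univ) q
  rw [← sum_apply]
  refine DFunLike.congr_fun (derivation_ext fun j => ?_) p
  simp [sum_apply, mkDerivation_X, pderiv_X, Pi.single_apply]

theorem dOp_eq_mkDerivation (n : ℕ) :
    dOp n = (mkDerivation ℤ fun i : Fin n => (X i ^ 2 : MvPolynomial (Fin n) ℤ)).toLinearMap :=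
  LinearMap.ext fun p => by simp [dOp, mkDerivation_apply_eq_sum_pderiv]

theorem zOp_eq_mkDerivation (n : ℕ) :
    zOp n = (mkDerivation ℤ fun _ : Fin n => (1 : MvPolynomial (Fin n) ℤ)).toLinearMap :=
  LinearMap.ext fun p => by simp [zOp, mkDerivation_apply_eq_sum_pderiv]

theorem hOp_eq_mkDerivation (n : ℕ) :
    hOp n = (mkDerivation ℤ fun i : Fin n => (2 * X i : MvPolynomial (Fin n) ℤ)).toLinearMap :=
  LinearMap.ext fun p => by
    simp [hOp, mkDerivation_apply_eq_sum_pderiv, Finset.mul_sum, mul_assoc]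

/-- A commutator relation between derivations of a polynomial ring may be checked on the
variables. -/
theorem comp_sub_comp_eq_of_apply_X {R σ : Type*} [CommRing R]
    {D₁ D₂ D : Derivation R (MvPolynomial σ R) (MvPolynomial σ R)}
    (h : ∀ i, D₁ (D₂ (X i)) - D₂ (D₁ (X i)) = D (X i)) :
    D₁.toLinearMap ∘ₗ D₂.toLinearMap - D₂.toLinearMap ∘ₗ D₁.toLinearMap = D.toLinearMap := by
  have hD : ⁅D₁, D₂⁆ = D := derivation_ext fun i => by rw [Derivation.commutator_apply, h i]
  rw [← hD]
  rfl

/-- The operators `d, h, z` on `R_n = ℤ[x_1,…,x_n]` satisfy the `sl₂`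
relations as ℤ-linear endomorphisms: `[h,d] = 2d`, `[h,z] = −2z`, and `[z,d] = h`,
where `[a,b] = a∘b − b∘a`.  Hence `(d, h, −z)` is an `sl₂`-triple acting on `R_n`. -/
theorem sl2_relations_on_polynomials (n : ℕ) :
    hOp n ∘ₗ dOp n - dOp n ∘ₗ hOp n = 2 • dOp n ∧
    hOp n ∘ₗ zOp n - zOp n ∘ₗ hOp n = -(2 • zOp n) ∧
    zOp n ∘ₗ dOp n - dOp n ∘ₗ zOp n = hOp n := by
  rw [hOp_eq_mkDerivation, dOp_eq_mkDerivation, zOp_eq_mkDerivation]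
  have map_two_mul (D : Derivation ℤ (MvPolynomial (Fin n) ℤ) (MvPolynomial (Fin n) ℤ))
      (p : MvPolynomial (Fin n) ℤ) : D (2 * p) = 2 * D p := by
    rw [two_mul, map_add, two_mul]
  simp only [two_nsmul, ← Derivation.coe_add_linearMap, ← Derivation.coe_neg_linearMap]
  refine ⟨comp_sub_comp_eq_of_apply_X fun i => ?_, comp_sub_comp_eq_of_apply_X fun i => ?_,
    comp_sub_comp_eq_of_apply_X fun i => ?_⟩
  · simp only [Derivation.add_apply, mkDerivation_X, map_two_mul, Derivation.leibniz_pow,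
      smul_eq_mul, nsmul_eq_mul]
    push_cast
    ring
  · simp only [Derivation.add_apply, Derivation.neg_apply, mkDerivation_X, map_two_mul,
      Derivation.map_one_eq_zero]
    ring
  · simp only [mkDerivation_X, Derivation.leibniz_pow, Derivation.map_one_eq_zero,
      smul_eq_mul, nsmul_eq_mul]
    push_cast
    ring
end

section
/- For every polynomial p ∈ R_n = ℤ[x_1,…,x_n] and every integer k ≥ 0, the k-fold iterate d^k(p) of the derivation d applied to p is divisible by k! in R_n. Hence the divided power operators d^(k) = d^k / k! are defined integrally on R_n, i.e. there is a ℤ-linear operator d^(k) on R_n with k!·d^(k)(p) = d^k(p) for all p. -/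
open MvPolynomial

theorem dOp_apply (n : ℕ) (p : MvPolynomial (Fin n) ℤ) :
    dOp n p = ∑ i : Fin n, X i ^ 2 * pderiv i p := by
  simp [dOp]

theorem dOp_X (n : ℕ) (i : Fin n) : dOp n (X i) = X i ^ 2 := by
  simp [dOp_apply, pderiv_X, Pi.single_apply]

theorem dOp_mul (n : ℕ) (p q : MvPolynomial (Fin n) ℤ) :
    dOp n (p * q) = p * dOp n q + q * dOp n p := by
  simp only [dOp_apply, Derivation.leibniz, smul_eq_mul, Finset.mul_sum,
    ← Finset.sum_add_distrib]
  exact Finset.sum_congr rfl fun i _ => by ring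

/-- The divided powers of `p * X i`, given the divided powers `f` of `p`. -/
noncomputable def dividedMulX {n : ℕ} (f : ℕ → MvPolynomial (Fin n) ℤ) (i : Fin n) :
    ℕ → MvPolynomial (Fin n) ℤ
  | 0 => f 0 * X i
  | k + 1 => f (k + 1) * X i + X i * dividedMulX f i k

theorem dOp_dividedMulX {n : ℕ} {f : ℕ → MvPolynomial (Fin n) ℤ}
    (hf : ∀ k : ℕ, dOp n (f k) = (k + 1) * f (k + 1)) (i : Fin n) (k : ℕ) :
    dOp n (dividedMulX f i k) = (k + 1) * dividedMulX f i (k + 1) := by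
  induction k with
  | zero =>
    simp only [dividedMulX, dOp_mul, dOp_X, hf]
    push_cast
    ring
  | succ k ih =>
    have step (m : ℕ) :
        dividedMulX f i (m + 1) = f (m + 1) * X i + X i * dividedMulX f i m := rfl
    rw [step (k + 1), step k, map_add, dOp_mul, dOp_mul, ih, hf, dOp_X, step k]
    push_cast
    ring

theorem exists_divided_powers {n : ℕ} (p : MvPolynomial (Fin n) ℤ) :
    ∃ f : ℕ → MvPolynomial (Fin n) ℤ,
      f 0 = p ∧ ∀ k : ℕ, dOp n (f k) = (k + 1) * f (k + 1) := by
  induction p using MvPolynomial.induction_on with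
  | C a =>
    refine ⟨fun k => if k = 0 then C a else 0, by simp, fun k => ?_⟩
    rcases k with _ | k <;> simp [dOp_apply]
  | add p q hp hq =>
    obtain ⟨f, rfl, hf⟩ := hp
    obtain ⟨g, rfl, hg⟩ := hq
    exact ⟨f + g, rfl, fun k => by simp [hf, hg, mul_add]⟩
  | mul_X p i hp =>
    obtain ⟨f, rfl, hf⟩ := hp
    exact ⟨dividedMulX f i, rfl, dOp_dividedMulX hf i⟩

theorem exists_dOp_pow_eq_factorial_smul (n k : ℕ) (p : MvPolynomial (Fin n) ℤ) :
    ∃ q : MvPolynomial (Fin n) ℤ, (dOp n ^ k) p = (k.factorial : ℤ) • q := by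
  obtain ⟨f, rfl, hf⟩ := exists_divided_powers p
  refine ⟨f k, ?_⟩
  induction k with
  | zero => simp
  | succ k ih =>
    rw [pow_succ', Module.End.mul_apply, ih, map_smul, hf, Nat.factorial_succ]
    simp only [zsmul_eq_mul]
    push_cast
    ring

/-- For every `p ∈ R_n = ℤ[x_1,…,x_n]` and every `k ≥ 0`, the `k`-fold
iterate `d^k(p)` is divisible by `k!` in `R_n`.  Hence the divided power operator
`d^(k) = d^k/k!` is defined integrally: there is a ℤ-linear operator `D` on `R_n`
with `k!·D(p) = d^k(p)` for all `p`. -/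
theorem dOp_divided_powers_integral (n k : ℕ) :
    (∀ p : MvPolynomial (Fin n) ℤ, ∃ q : MvPolynomial (Fin n) ℤ,
      (dOp n ^ k) p = (k.factorial : ℤ) • q) ∧
    ∃ D : MvPolynomial (Fin n) ℤ →ₗ[ℤ] MvPolynomial (Fin n) ℤ,
      ∀ p : MvPolynomial (Fin n) ℤ, (k.factorial : ℤ) • D p = (dOp n ^ k) p := by
  refine ⟨exists_dOp_pow_eq_factorial_smul n k, ?_⟩
  choose D hD using exists_dOp_pow_eq_factorial_smul n k
  have hk : (k.factorial : ℤ) ≠ 0 := by exact_mod_cast k.factorial_ne_zero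
  refine ⟨{ toFun := D, map_add' := fun p q => ?_, map_smul' := fun a p => ?_ },
    fun p => (hD p).symm⟩
  · apply smul_right_injective _ hk
    simp only [smul_add, ← hD, map_add]
  · apply smul_right_injective _ hk
    simp only [RingHom.id_apply, smul_comm _ a, ← hD, map_smul]
end
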